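/- Fix d ≥ 1, 0 < α < ∞, constants C₁, C₂, C₃, ε₀, δ₁, δ₂, f_max > 0 and 0 < γ < f_max, and let f be a density on [0,1]^d bounded by f_max satisfying assumptions [A1], [A2] and [B]. Let s_n be a monotone diverging sequence and j' = ⌊j + log₂ s_n⌋. If n is large enough that s_n > 8·max(3ε₀^{-1}, 28, 12C₃)·√d, then for all integers j ≥ 0: min(δ₁, C₁)·2^{-j'α} ≤ V_{γ,j} ≤ max(C₂, f_max/δ₂^α)·(√d·2^{-j})^α. -/

import Mathlib

open MeasureTheory Filter

noncomputable section

abbrev Pt (d : ℕ) := EuclideanSpace ℝ (Fin d)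

/-- The unit cube `[0,1]^d`. -/
def cube (d : ℕ) : Set (Pt d) := {x | ∀ i, 0 ≤ x i ∧ x i ≤ 1}

/-- The closed `ε`-ball around `x`, relative to the cube `[0,1]^d`. -/
def ballC (d : ℕ) (x : Pt d) (ε : ℝ) : Set (Pt d) := {y ∈ cube d | dist y x ≤ ε}

/-- The inner `ε`-cover of `G`: the union of all `ε`-balls contained in `G`. -/
def innerCover (d : ℕ) (ε : ℝ) (G : Set (Pt d)) : Set (Pt d) :=
  ⋃ x ∈ {x : Pt d | ballC d x ε ⊆ G}, ballC d x ε

open Classical in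
/-- The Hausdorff error `d_∞(G₁, G₂)`, defined as `√d` if either set is empty. -/
def hausd (d : ℕ) (G₁ G₂ : Set (Pt d)) : ℝ :=
  if G₁.Nonempty ∧ G₂.Nonempty then
    max (⨆ x ∈ G₂, Metric.infDist x G₁) (⨆ x ∈ G₁, Metric.infDist x G₂)
  else Real.sqrt d

/-- Indices for the cells of the regular partition of `[0,1]^d` at resolution `j`. -/
abbrev CellIdx (d j : ℕ) := Fin d → Fin (2 ^ j)

/-- The dyadic hypercube cell of sidelength `2⁻ʲ` indexed by `k` (cells on the
upper boundary of the cube are closed on the right, so that the cells partition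
`[0,1]^d`). -/
def cell (d j : ℕ) (k : CellIdx d j) : Set (Pt d) :=
  {x | ∀ i, ((k i : ℕ) : ℝ) / 2 ^ j ≤ x i ∧
    (x i < (((k i : ℕ) : ℝ) + 1) / 2 ^ j ∨ ((k i : ℕ) + 1 = 2 ^ j ∧ x i ≤ 1))}

/-- Empirical probability of a set `A`. -/
def Phat {d n : ℕ} (ω : Fin n → Pt d) (A : Set (Pt d)) : ℝ :=
  (∑ i, A.indicator (fun _ => (1 : ℝ)) (ω i)) / n

/-- Empirical average density `f̂(A) = P̂(A)/μ(A)` of the cell indexed by `k`. -/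
def fhat {d n : ℕ} (j : ℕ) (ω : Fin n → Pt d) (k : CellIdx d j) : ℝ :=
  Phat ω (cell d j k) * 2 ^ (j * d)

/-- True average density `f̄(A) = P(A)/μ(A)` of the cell indexed by `k`. -/
def fbar {d : ℕ} (P : Measure (Pt d)) (j : ℕ) (k : CellIdx d j) : ℝ :=
  (P (cell d j k)).toReal * 2 ^ (j * d)

/-- The plug-in level set estimator at resolution `j`. -/
def Ghat (d n j : ℕ) (γ : ℝ) (ω : Fin n → Pt d) : Set (Pt d) :=
  ⋃ k ∈ {k : CellIdx d j | γ ≤ fhat j ω k}, cell d j k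

/-- The `γ`-level set of `f` on `[0,1]^d`. -/
def Gstar (d : ℕ) (f : Pt d → ℝ) (γ : ℝ) : Set (Pt d) := {x ∈ cube d | γ ≤ f x}

/-- The penalty `Ψ_j` at resolution `j` with confidence parameter `δ`. -/
def pen (d n j : ℕ) (δ : ℝ) (ω : Fin n → Pt d) : ℝ :=
  ⨆ k : CellIdx d j,
    Real.sqrt (8 * (Real.log ((2 : ℝ) ^ (j * (d + 1)) * 16 / δ) / ((n : ℝ) / 2 ^ (j * d))) *
      max (fhat j ω k)
        (8 * (Real.log ((2 : ℝ) ^ (j * (d + 1)) * 16 / δ) / ((n : ℝ) / 2 ^ (j * d)))))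

/-- `j' = ⌊j + log₂ s⌋`. -/
def jprime (j : ℕ) (s : ℝ) : ℕ := (⌊(j : ℝ) + Real.logb 2 s⌋).toNat

/-- Generic vernier: min over cells at resolution `j` of the max over subcells at
resolution `j'` of `|γ - g(A')|`. -/
def vernier (d : ℕ) (γ : ℝ) (j j' : ℕ) (g : CellIdx d j' → ℝ) : ℝ :=
  ⨅ k : CellIdx d j, ⨆ k' : {k' : CellIdx d j' // cell d j' k' ⊆ cell d j k}, |γ - g k'.1|

/-- The vernier `V_{γ,j}`. -/
def V (d : ℕ) (P : Measure (Pt d)) (γ : ℝ) (j j' : ℕ) : ℝ := vernier d γ j j' (fbar P j')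

/-- The empirical vernier `V̂_{γ,j}`. -/
def Vhat (d n : ℕ) (ω : Fin n → Pt d) (γ : ℝ) (j j' : ℕ) : ℝ := vernier d γ j j' (fhat j' ω)

/-- The joint distribution of `n` i.i.d. observations from `P`. -/
def Pn {d : ℕ} (P : Measure (Pt d)) (n : ℕ) : Measure (Fin n → Pt d) :=
  Measure.pi fun _ => P

/-- `f` is a probability density (w.r.t. Lebesgue measure) supported on the unit cube,
and `P` is the corresponding probability measure. -/
def IsDensity (d : ℕ) (f : Pt d → ℝ) (P : Measure (Pt d)) : Prop :=
  Measurable f ∧ (∀ x, 0 ≤ f x) ∧ (∀ x, x ∉ cube d → f x = 0) ∧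
  P = volume.withDensity (fun x => ENNReal.ofReal (f x)) ∧ IsProbabilityMeasure P

/-- The density `f` is bounded by `fmax`. -/
def BoundedBy (d : ℕ) (f : Pt d → ℝ) (fmax : ℝ) : Prop := ∀ x, f x ≤ fmax

/-- Assumption [A1]: local density regularity (lower bound). -/
def A1 (d : ℕ) (f : Pt d → ℝ) (γ C₁ δ₁ α : ℝ) : Prop :=
  ∀ x ∈ cube d, |f x - γ| ≤ δ₁ →
    C₁ * Metric.infDist x (frontier (Gstar d f γ)) ^ α ≤ |f x - γ|

/-- Assumption [A2]: local density regularity (upper bound near some boundary point). -/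
def A2 (d : ℕ) (f : Pt d → ℝ) (γ C₂ δ₂ α : ℝ) : Prop :=
  ∃ x₀ ∈ frontier (Gstar d f γ), ∀ x ∈ ballC d x₀ δ₂,
    |f x - γ| ≤ C₂ * Metric.infDist x (frontier (Gstar d f γ)) ^ α

/-- Assumption [B]: level set regularity. -/
def AB (d : ℕ) (G : Set (Pt d)) (C₃ ε₀ : ℝ) : Prop :=
  ∀ ε : ℝ, 0 < ε → ε ≤ ε₀ →
    (innerCover d ε G).Nonempty ∧
    ∀ x ∈ frontier G, Metric.infDist x (innerCover d ε G) ≤ C₃ * ε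


lemma dist_le_sqrt_mul {d : ℕ} {x y : Pt d} {r : ℝ} (hr : 0 ≤ r) (h : ∀ i, |x i - y i| ≤ r) :
    dist x y ≤ Real.sqrt d * r := by
  rw [EuclideanSpace.dist_eq]
  have hsum : ∑ i, dist (x i) (y i) ^ 2 ≤ d * r ^ 2 := by
    calc ∑ i, dist (x i) (y i) ^ 2 ≤ ∑ _i : Fin d, r ^ 2 := by
          refine Finset.sum_le_sum fun i _ => ?_
          rw [Real.dist_eq]
          exact pow_le_pow_left₀ (abs_nonneg _) (h i) 2
      _ = d * r ^ 2 := by simp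
  calc √(∑ i, dist (x i) (y i) ^ 2) ≤ √(d * r ^ 2) := Real.sqrt_le_sqrt hsum
    _ = √d * r := by rw [Real.sqrt_mul (Nat.cast_nonneg d), Real.sqrt_sq hr]

lemma coord_bounds_of_mem_cell {d j : ℕ} {k : CellIdx d j} {x : Pt d} (hx : x ∈ cell d j k)
    (i : Fin d) : ((k i : ℕ) : ℝ) / 2 ^ j ≤ x i ∧ x i ≤ (((k i : ℕ) : ℝ) + 1) / 2 ^ j := by
  refine ⟨(hx i).1, ?_⟩
  rcases (hx i).2 with h | ⟨h, h'⟩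
  · exact h.le
  · have hk : ((k i : ℕ) : ℝ) + 1 = 2 ^ j := by exact_mod_cast h
    rw [hk, div_self (by positivity)]
    exact h'

lemma cell_subset_cube {d j : ℕ} (k : CellIdx d j) : cell d j k ⊆ cube d := by
  intro x hx i
  obtain ⟨h₁, h₂⟩ := coord_bounds_of_mem_cell hx i
  refine ⟨le_trans (by positivity) h₁, h₂.trans ?_⟩
  rw [div_le_one (by positivity)]
  have hk : (k i : ℕ) + 1 ≤ 2 ^ j := (k i).isLt
  exact (Nat.cast_add_one (R := ℝ) (k i : ℕ)) ▸ (Nat.cast_le.2 hk).trans_eq (by push_cast; rfl)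

lemma dist_le_of_mem_cell {d j : ℕ} {k : CellIdx d j} {x y : Pt d} (hx : x ∈ cell d j k)
    (hy : y ∈ cell d j k) : dist x y ≤ Real.sqrt d * ((2 : ℝ) ^ j)⁻¹ := by
  refine dist_le_sqrt_mul (by positivity) fun i => ?_
  obtain ⟨h₁, h₂⟩ := coord_bounds_of_mem_cell hx i
  obtain ⟨h₃, h₄⟩ := coord_bounds_of_mem_cell hy i
  rw [add_div, one_div] at h₂ h₄
  rw [abs_le]
  constructor <;> linarith

lemma exists_mem_cell {d : ℕ} (j : ℕ) {x : Pt d} (hx : x ∈ cube d) :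
    ∃ k : CellIdx d j, x ∈ cell d j k := by
  have h2 : (0 : ℝ) < 2 ^ j := by positivity
  have key : ∀ i, ∃ m : Fin (2 ^ j), ((m : ℕ) : ℝ) / 2 ^ j ≤ x i ∧
      (x i < (((m : ℕ) : ℝ) + 1) / 2 ^ j ∨ ((m : ℕ) + 1 = 2 ^ j ∧ x i ≤ 1)) := by
    intro i
    obtain ⟨h0, h1⟩ := hx i
    rcases h1.lt_or_eq with hlt | heq
    · have hn : 0 ≤ x i * 2 ^ j := by positivity
      refine ⟨⟨⌊x i * 2 ^ j⌋₊, ?_⟩, ?_, Or.inl ?_⟩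
      · rw [Nat.floor_lt hn]
        push_cast
        nlinarith
      · rw [div_le_iff₀ h2]
        exact Nat.floor_le hn
      · rw [lt_div_iff₀ h2]
        exact Nat.lt_floor_add_one _
    · have hpos : 0 < 2 ^ j := by positivity
      have hm : 2 ^ j - 1 + 1 = 2 ^ j := Nat.sub_add_cancel hpos
      refine ⟨⟨2 ^ j - 1, by omega⟩, ?_, Or.inr ⟨hm, h1⟩⟩
      rw [heq, div_le_one h2]
      exact_mod_cast Nat.sub_le (2 ^ j) 1
  choose k hk using key
  exact ⟨k, hk⟩

/-- The centre of a cell. -/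
def cellCenter {d j : ℕ} (k : CellIdx d j) : Pt d :=
  WithLp.toLp 2 fun i => (((k i : ℕ) : ℝ) + 1 / 2) / 2 ^ j

lemma ball_cellCenter_subset {d j : ℕ} (k : CellIdx d j) :
    Metric.ball (cellCenter k) (((2 : ℝ) ^ j)⁻¹ / 2) ⊆ cell d j k := by
  intro x hx i
  have h : |x i - (((k i : ℕ) : ℝ) + 1 / 2) / 2 ^ j| < ((2 : ℝ) ^ j)⁻¹ / 2 := by
    have := (PiLp.dist_apply_le x (cellCenter k) i).trans_lt (Metric.mem_ball.1 hx)
    simpa [Real.dist_eq, cellCenter] using this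
  rw [abs_lt, add_div, one_div, div_eq_mul_inv 2⁻¹] at h
  refine ⟨by linarith [h.1], Or.inl ?_⟩
  rw [add_div, one_div]
  linarith [h.2]

/-- The side of a cell along one coordinate. -/
def cellSide (j : ℕ) (m : Fin (2 ^ j)) : Set ℝ :=
  {t | ((m : ℕ) : ℝ) / 2 ^ j ≤ t ∧
    (t < (((m : ℕ) : ℝ) + 1) / 2 ^ j ∨ ((m : ℕ) + 1 = 2 ^ j ∧ t ≤ 1))}

lemma measurableSet_cellSide (j : ℕ) (m : Fin (2 ^ j)) : MeasurableSet (cellSide j m) :=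
  measurableSet_Ici.inter (measurableSet_Iio.union ((MeasurableSet.const _).inter measurableSet_Iic))

lemma volume_cellSide (j : ℕ) (m : Fin (2 ^ j)) :
    volume (cellSide j m) = ENNReal.ofReal ((2 : ℝ) ^ j)⁻¹ := by
  have hlen : (((m : ℕ) : ℝ) + 1) / 2 ^ j - ((m : ℕ) : ℝ) / 2 ^ j = ((2 : ℝ) ^ j)⁻¹ := by ring
  by_cases hm : (m : ℕ) + 1 = 2 ^ j
  · have h1 : (((m : ℕ) : ℝ) + 1) / 2 ^ j = 1 := by
      rw [div_eq_one_iff_eq (by positivity)]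
      exact_mod_cast hm
    have : cellSide j m = Set.Icc (((m : ℕ) : ℝ) / 2 ^ j) ((((m : ℕ) : ℝ) + 1) / 2 ^ j) := by
      ext t
      simp only [cellSide, hm, h1, true_and, Set.mem_ofPred_eq, Set.mem_Icc]
      exact and_congr_right fun _ => ⟨fun h => h.elim le_of_lt id, Or.inr⟩
    rw [this, Real.volume_Icc, hlen]
  · have : cellSide j m = Set.Ico (((m : ℕ) : ℝ) / 2 ^ j) ((((m : ℕ) : ℝ) + 1) / 2 ^ j) := by
      ext t
      simp [cellSide, hm]
    rw [this, Real.volume_Ico, hlen]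

lemma cell_eq_preimage {d j : ℕ} (k : CellIdx d j) :
    cell d j k = (WithLp.ofLp : Pt d → Fin d → ℝ) ⁻¹'
      (Set.univ.pi fun i => cellSide j (k i)) := by
  ext x
  simp [cell, cellSide]

lemma measurableSet_cell {d j : ℕ} (k : CellIdx d j) : MeasurableSet (cell d j k) := by
  rw [cell_eq_preimage]
  exact (PiLp.volume_preserving_ofLp (Fin d)).measurable
    (MeasurableSet.univ_pi fun i => measurableSet_cellSide j (k i))

lemma volume_cell {d j : ℕ} (k : CellIdx d j) :
    volume (cell d j k) = ENNReal.ofReal ((2 : ℝ) ^ (j * d))⁻¹ := by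
  rw [cell_eq_preimage, (PiLp.volume_preserving_ofLp (Fin d)).measure_preimage
    (MeasurableSet.univ_pi fun i => measurableSet_cellSide j (k i)).nullMeasurableSet,
    volume_pi_pi]
  simp only [volume_cellSide, Finset.prod_const, Finset.card_univ, Fintype.card_fin]
  rw [← ENNReal.ofReal_pow (by positivity), inv_pow, ← pow_mul]

lemma IsDensity.apply_cell {d : ℕ} {f : Pt d → ℝ} {P : Measure (Pt d)} (hf : IsDensity d f P)
    {j : ℕ} (k : CellIdx d j) :
    P (cell d j k) = ∫⁻ x in cell d j k, ENNReal.ofReal (f x) := by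
  rw [hf.2.2.2.1, withDensity_apply _ (measurableSet_cell k)]

lemma fbar_le {d : ℕ} {f : Pt d → ℝ} {P : Measure (Pt d)} (hf : IsDensity d f P) {j : ℕ}
    (k : CellIdx d j) {c : ℝ} (hc : 0 ≤ c) (h : ∀ x ∈ cell d j k, f x ≤ c) :
    fbar P j k ≤ c := by
  have hle : P (cell d j k) ≤ ENNReal.ofReal (c * ((2 : ℝ) ^ (j * d))⁻¹) := by
    rw [hf.apply_cell, ENNReal.ofReal_mul hc, ← volume_cell k, ← setLIntegral_const]
    exact setLIntegral_mono measurable_const fun x hx => ENNReal.ofReal_le_ofReal (h x hx)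
  have := ENNReal.toReal_le_of_le_ofReal (by positivity) hle
  rwa [← div_eq_mul_inv, le_div_iff₀ (by positivity)] at this

lemma le_fbar {d : ℕ} {f : Pt d → ℝ} {P : Measure (Pt d)} (hf : IsDensity d f P) {j : ℕ}
    (k : CellIdx d j) {c : ℝ} (h : ∀ x ∈ cell d j k, c ≤ f x) :
    c ≤ fbar P j k := by
  rcases le_total c 0 with hc | hc
  · exact hc.trans (mul_nonneg ENNReal.toReal_nonneg (by positivity))
  have := hf.2.2.2.2
  have hle : ENNReal.ofReal (c * ((2 : ℝ) ^ (j * d))⁻¹) ≤ P (cell d j k) := by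
    rw [hf.apply_cell, ENNReal.ofReal_mul hc, ← volume_cell k, ← setLIntegral_const]
    exact setLIntegral_mono (ENNReal.measurable_ofReal.comp hf.1)
      fun x hx => ENNReal.ofReal_le_ofReal (h x hx)
  have := (ENNReal.ofReal_le_iff_le_toReal (measure_ne_top P _)).1 hle
  rwa [← div_eq_mul_inv, div_le_iff₀ (by positivity)] at this

lemma two_pow_lt_two_pow_jprime (j : ℕ) {s : ℝ} (hs : 1 ≤ s) :
    (2 : ℝ) ^ j * s < 2 * 2 ^ jprime j s := by
  have hnn : 0 ≤ ⌊(j : ℝ) + Real.logb 2 s⌋ :=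
    Int.floor_nonneg.2 (add_nonneg (Nat.cast_nonneg j) (Real.logb_nonneg one_lt_two hs))
  have hcast : ((jprime j s : ℕ) : ℝ) = (⌊(j : ℝ) + Real.logb 2 s⌋ : ℝ) := by
    unfold jprime
    exact_mod_cast Int.toNat_of_nonneg hnn
  have hlt : (j : ℝ) + Real.logb 2 s < jprime j s + 1 := by
    rw [hcast]
    exact Int.lt_floor_add_one _
  have := Real.rpow_lt_rpow_of_exponent_lt one_lt_two hlt
  rw [Real.rpow_add two_pos, Real.rpow_add two_pos, Real.rpow_logb two_pos (by norm_num)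
    (by linarith), Real.rpow_natCast, Real.rpow_natCast, Real.rpow_one] at this
  linarith

lemma vernier_le {d : ℕ} {γ M : ℝ} {j j' : ℕ} {g : CellIdx d j' → ℝ} (k : CellIdx d j)
    (hM : 0 ≤ M) (h : ∀ k', cell d j' k' ⊆ cell d j k → |γ - g k'| ≤ M) :
    vernier d γ j j' g ≤ M :=
  (ciInf_le (Set.finite_range _).bddBelow k).trans (Real.iSup_le (fun k' => h k'.1 k'.2) hM)

lemma le_vernier {d : ℕ} {γ m : ℝ} {j j' : ℕ} {g : CellIdx d j' → ℝ}
    (h : ∀ k : CellIdx d j, ∃ k', cell d j' k' ⊆ cell d j k ∧ m ≤ |γ - g k'|) :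
    m ≤ vernier d γ j j' g := by
  have : Nonempty (CellIdx d j) := ⟨fun _ => ⟨0, by positivity⟩⟩
  refine le_ciInf fun k => ?_
  obtain ⟨k', hk', hm⟩ := h k
  exact hm.trans (le_ciSup
    (f := fun k' : {k' : CellIdx d j' // cell d j' k' ⊆ cell d j k} => |γ - g k'.1|)
    (Set.finite_range _).bddAbove ⟨k', hk'⟩)

lemma isClosed_cube (d : ℕ) : IsClosed (cube d) := by
  have : cube d = ⋂ i, {x : Pt d | 0 ≤ x i ∧ x i ≤ 1} := by
    ext x
    simp [cube]
  rw [this]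
  refine isClosed_iInter fun i => ?_
  have hi : Continuous fun x : Pt d => x i := by fun_prop
  exact (isClosed_le continuous_const hi).inter (isClosed_le hi continuous_const)

lemma frontier_Gstar_subset_cube (d : ℕ) (f : Pt d → ℝ) (γ : ℝ) :
    frontier (Gstar d f γ) ⊆ cube d :=
  frontier_subset_closure.trans (closure_minimal (fun _ hx => hx.1) (isClosed_cube d))

lemma V_le {d : ℕ} {α C₂ δ₂ fmax γ : ℝ} (hα : 0 < α) (hC₂ : 0 < C₂) (hδ₂ : 0 < δ₂)
    (hγ : 0 < γ) (hγf : γ < fmax) {f : Pt d → ℝ} {P : Measure (Pt d)} (hf : IsDensity d f P)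
    (hb : BoundedBy d f fmax) (hA2 : A2 d f γ C₂ δ₂ α) (j j' : ℕ) :
    V d P γ j j' ≤ max C₂ (fmax / δ₂ ^ α) * (Real.sqrt d * ((2 : ℝ) ^ j)⁻¹) ^ α := by
  obtain ⟨x₀, hx₀, h⟩ := hA2
  obtain ⟨k, hk⟩ := exists_mem_cell j (frontier_Gstar_subset_cube d f γ hx₀)
  set R := Real.sqrt d * ((2 : ℝ) ^ j)⁻¹ with hR
  have hR0 : 0 ≤ R := by positivity
  have hRα : 0 ≤ R ^ α := by positivity
  have hmax : 0 < max C₂ (fmax / δ₂ ^ α) := lt_max_of_lt_left hC₂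
  refine vernier_le k (by positivity) fun k' hk' => ?_
  rcases le_or_gt R δ₂ with hRδ | hRδ
  · have hfx : ∀ x ∈ cell d j' k', |f x - γ| ≤ max C₂ (fmax / δ₂ ^ α) * R ^ α := by
      intro x hx
      have hd : dist x x₀ ≤ R := dist_le_of_mem_cell (hk' hx) hk
      refine (h x ⟨cell_subset_cube _ hx, hd.trans hRδ⟩).trans ?_
      exact mul_le_mul (le_max_left _ _)
        (Real.rpow_le_rpow Metric.infDist_nonneg
          ((Metric.infDist_le_dist_of_mem hx₀).trans hd) hα.le)
        (Real.rpow_nonneg Metric.infDist_nonneg _) hmax.le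
    have h₁ := fbar_le hf k' (c := γ + max C₂ (fmax / δ₂ ^ α) * R ^ α) (by positivity)
      fun x hx => by linarith [(abs_le.1 (hfx x hx)).2]
    have h₂ := le_fbar hf k' (c := γ - max C₂ (fmax / δ₂ ^ α) * R ^ α)
      fun x hx => by linarith [(abs_le.1 (hfx x hx)).1]
    rw [abs_le]
    constructor <;> linarith
  · have h₁ := fbar_le hf k' (hγ.trans hγf).le fun x _ => hb x
    have h₂ := le_fbar hf k' (c := 0) fun x _ => hf.2.1 x
    have hδα : 0 < δ₂ ^ α := Real.rpow_pos_of_pos hδ₂ α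
    have h₃ : fmax ≤ max C₂ (fmax / δ₂ ^ α) * R ^ α :=
      calc fmax = fmax / δ₂ ^ α * δ₂ ^ α := by field_simp
        _ ≤ max C₂ (fmax / δ₂ ^ α) * R ^ α :=
          mul_le_mul (le_max_right _ _) (Real.rpow_le_rpow hδ₂.le hRδ.le hα.le) hδα.le hmax.le
    refine le_trans ?_ h₃
    rw [abs_le]
    constructor <;> linarith

lemma inter_frontier_nonempty_of_isPreconnected {X : Type*} [TopologicalSpace X] {t G : Set X}
    (ht : IsPreconnected t) (h : (t ∩ G).Nonempty) (h' : (t ∩ Gᶜ).Nonempty) :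
    (t ∩ frontier G).Nonempty := by
  by_contra hcon
  have hfr : ∀ x ∈ t, x ∉ frontier G := fun x hx hxG => hcon ⟨x, hx, hxG⟩
  have hin : ∀ x ∈ t, x ∈ G → x ∈ interior G := fun x hx hxG =>
    by_contra fun hn => hfr x hx ⟨subset_closure hxG, hn⟩
  have hout : ∀ x ∈ t, x ∉ G → x ∈ interior Gᶜ := fun x hx hxG =>
    by_contra fun hn => hfr x hx (frontier_compl G ▸ ⟨subset_closure hxG, hn⟩)
  obtain ⟨x, -, hx, hx'⟩ := ht _ _ isOpen_interior isOpen_interior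
    (fun x hx => (em (x ∈ G)).imp (hin x hx) (hout x hx))
    (h.imp fun x hx => ⟨hx.1, hin x hx.1 hx.2⟩) (h'.imp fun x hx => ⟨hx.1, hout x hx.1 hx.2⟩)
  exact interior_subset hx' (interior_subset hx)

/-- Under the inner cover condition, every cell contains a ball of radius `2 * D` which lies on one
side of the level set, provided `D` is small compared with the sidelength of the cell. -/
lemma exists_ball_subset_or_subset_compl {d j : ℕ} {G : Set (Pt d)} {C₃ ε₀ D : ℝ}
    (hB : AB d G C₃ ε₀) (hD : 0 < D) (hDε : 3 * D ≤ ε₀) (hD28 : 112 * D < ((2 : ℝ) ^ j)⁻¹)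
    (hDC : 48 * C₃ * D < ((2 : ℝ) ^ j)⁻¹) (k : CellIdx d j) :
    ∃ y, Metric.ball y (2 * D) ⊆ cell d j k ∧
      (Metric.ball y (2 * D) ⊆ G ∨ Metric.ball y (2 * D) ⊆ Gᶜ) := by
  set L := ((2 : ℝ) ^ j)⁻¹ with hL
  have hcell : ∀ y, dist y (cellCenter k) + 2 * D ≤ L / 2 → Metric.ball y (2 * D) ⊆ cell d j k :=
    fun y hy => (Metric.ball_subset_ball' (by linarith)).trans (ball_cellCenter_subset k)
  by_cases hfr : ∃ x ∈ frontier G, dist x (cellCenter k) < L / 4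
  · obtain ⟨x, hx, hxc⟩ := hfr
    obtain ⟨hne, hdist⟩ := hB (3 * D) (by positivity) hDε
    obtain ⟨z, hz, hxz⟩ := (Metric.infDist_lt_iff hne).1
      ((hdist x hx).trans_lt (lt_add_of_pos_right _ hD))
    simp only [innerCover, Set.mem_iUnion, Set.mem_ofPred_eq, exists_prop] at hz
    obtain ⟨y, hyG, -, hzy⟩ := hz
    have hyc : dist y (cellCenter k) ≤ dist z y + dist x z + dist x (cellCenter k) := by
      rw [dist_comm z y, dist_comm x z]
      linarith [dist_triangle y z (cellCenter k), dist_triangle z x (cellCenter k)]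
    have hball := hcell y (by linarith)
    exact ⟨y, hball, Or.inl fun w hw =>
      hyG ⟨cell_subset_cube k (hball hw), by linarith [Metric.mem_ball.1 hw]⟩⟩
  · refine ⟨cellCenter k, hcell _ (by rw [dist_self]; linarith), ?_⟩
    by_contra! hcon
    obtain ⟨h₁, h₂⟩ := hcon
    obtain ⟨a, ha, haG⟩ := Set.not_subset.1 h₁
    obtain ⟨b, hb, hbG⟩ := Set.not_subset.1 h₂
    obtain ⟨x, hx, hxG⟩ := inter_frontier_nonempty_of_isPreconnected
      (convex_ball (cellCenter k) (2 * D)).isPreconnected ⟨b, hb, not_not.1 hbG⟩ ⟨a, ha, haG⟩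
    exact hfr ⟨x, hxG, by linarith [Metric.mem_ball.1 hx]⟩

lemma le_infDist_frontier {X : Type*} [PseudoMetricSpace X] {G : Set X} {x y : X} {r : ℝ}
    (hne : (frontier G).Nonempty)
    (hball : Metric.ball y (2 * r) ⊆ G ∨ Metric.ball y (2 * r) ⊆ Gᶜ) (hx : dist x y ≤ r) :
    r ≤ Metric.infDist x (frontier G) := by
  rw [Metric.le_infDist hne]
  intro z hz
  have hzy : z ∉ Metric.ball y (2 * r) := by
    intro hzb
    rcases hball with h | h
    · exact hz.2 (interior_maximal h Metric.isOpen_ball hzb)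
    · rw [← frontier_compl] at hz
      exact hz.2 (interior_maximal h Metric.isOpen_ball hzb)
  rw [Metric.mem_ball, not_lt] at hzy
  linarith [dist_triangle z x y, dist_comm z x]

lemma le_abs_sub_fbar {d : ℕ} {f : Pt d → ℝ} {P : Measure (Pt d)} (hf : IsDensity d f P)
    {γ m : ℝ} {j : ℕ} (k : CellIdx d j) (h : ∀ x ∈ cell d j k, m ≤ |f x - γ|)
    (hne : (cell d j k).Nonempty)
    (hside : cell d j k ⊆ Gstar d f γ ∨ cell d j k ⊆ (Gstar d f γ)ᶜ) :
    m ≤ |γ - fbar P j k| := by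
  rcases hside with hG | hG
  · have := le_fbar hf k (c := γ + m) fun x hx => by
      have := h x hx
      rw [abs_of_nonneg (sub_nonneg.2 (hG hx).2)] at this
      linarith
    exact le_trans (by linarith) (neg_le_abs _)
  · have hfx : ∀ x ∈ cell d j k, f x ≤ γ - m := fun x hx => by
      have hlt : f x < γ := lt_of_not_ge fun hge => hG hx ⟨cell_subset_cube k hx, hge⟩
      have := h x hx
      rw [abs_of_neg (sub_neg.2 hlt)] at this
      linarith
    obtain ⟨x, hx⟩ := hne
    have := fbar_le hf k ((hf.2.1 x).trans (hfx x hx)) hfx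
    exact le_trans (by linarith) (le_abs_self _)

lemma le_V {d : ℕ} (hd : 1 ≤ d) {α C₁ C₃ ε₀ δ₁ γ s : ℝ} (hα : 0 < α) (hC₁ : 0 < C₁)
    (hε₀ : 0 < ε₀) (hδ₁ : 0 < δ₁) {f : Pt d → ℝ} {P : Measure (Pt d)}
    (hf : IsDensity d f P) (hA1 : A1 d f γ C₁ δ₁ α) (hB : AB d (Gstar d f γ) C₃ ε₀)
    (hne : (frontier (Gstar d f γ)).Nonempty)
    (hs : 8 * max (3 * ε₀⁻¹) (max 28 (12 * C₃)) * Real.sqrt d < s) (j : ℕ) :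
    min δ₁ C₁ * (((2 : ℝ) ^ jprime j s)⁻¹) ^ α ≤ V d P γ j (jprime j s) := by
  have hsd : 1 ≤ Real.sqrt d := by
    rw [Real.one_le_sqrt]
    exact_mod_cast hd
  have hlow : ∀ c ≤ max (3 * ε₀⁻¹) (max 28 (12 * C₃)), 8 * c * Real.sqrt d < s := fun c hc =>
    lt_of_le_of_lt (by gcongr) hs
  have hs28 := hlow 28 ((le_max_left _ _).trans (le_max_right _ _))
  have hpow := two_pow_lt_two_pow_jprime j (s := s) (by linarith)
  set j' := jprime j s
  set D := Real.sqrt d * ((2 : ℝ) ^ j')⁻¹ with hDdef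
  have hDpos : 0 < D := by positivity
  have hrD : ((2 : ℝ) ^ j')⁻¹ ≤ D := le_mul_of_one_le_left (by positivity) hsd
  have hscale : ∀ c ≤ max (3 * ε₀⁻¹) (max 28 (12 * C₃)), 4 * c * D < ((2 : ℝ) ^ j)⁻¹ := by
    intro c hc
    have h2j : (0 : ℝ) < 2 ^ j := by positivity
    have h2j' : (0 : ℝ) < 2 ^ j' := by positivity
    have := mul_lt_mul_of_pos_left (hlow c hc) h2j
    rw [hDdef, ← mul_assoc, ← div_eq_mul_inv, ← one_div, div_lt_div_iff₀ h2j' h2j]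
    linarith
  have hDε : 3 * D ≤ ε₀ := by
    have h := hscale (3 * ε₀⁻¹) (le_max_left _ _)
    have h1 : ((2 : ℝ) ^ j)⁻¹ ≤ 1 := inv_le_one_of_one_le₀ (one_le_pow₀ one_le_two)
    have h2 : 4 * (3 * ε₀⁻¹) * D * ε₀ = 4 * (3 * D) := by field_simp
    nlinarith
  have hD28 : 112 * D < ((2 : ℝ) ^ j)⁻¹ := by
    linarith [hscale 28 ((le_max_left _ _).trans (le_max_right _ _))]
  have hDC : 48 * C₃ * D < ((2 : ℝ) ^ j)⁻¹ := by
    linarith [hscale (12 * C₃) ((le_max_right _ _).trans (le_max_right _ _))]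
  refine le_vernier fun k => ?_
  obtain ⟨y, hycell, hyG⟩ := exists_ball_subset_or_subset_compl hB hDpos hDε hD28 hDC k
  have hyc : y ∈ cell d j k := hycell (Metric.mem_ball_self (by positivity))
  obtain ⟨k', hk'⟩ := exists_mem_cell j' (cell_subset_cube k hyc)
  have hdist : ∀ x ∈ cell d j' k', dist x y ≤ D := fun x hx => dist_le_of_mem_cell hx hk'
  have hsub : cell d j' k' ⊆ Metric.ball y (2 * D) := fun x hx =>
    Metric.mem_ball.2 (by linarith [hdist x hx])
  refine ⟨k', hsub.trans hycell, le_abs_sub_fbar hf k' (fun x hx => ?_) ⟨y, hk'⟩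
    (hyG.imp hsub.trans hsub.trans)⟩
  rcases le_total |f x - γ| δ₁ with hle | hle
  · refine le_trans ?_ (hA1 x (cell_subset_cube k' hx) hle)
    exact mul_le_mul (min_le_right _ _) (Real.rpow_le_rpow (by positivity)
      (hrD.trans (le_infDist_frontier hne hyG (hdist x hx))) hα.le) (by positivity) hC₁.le
  · refine le_trans (mul_le_of_le_one_right (by positivity) ?_) ((min_le_left _ _).trans hle)
    exact Real.rpow_le_one (by positivity) (inv_le_one_of_one_le₀ (one_le_pow₀ one_le_two)) hα.le

/-- **Lemma B.1**: two-sided bound on the vernier,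
`min(δ₁, C₁) 2^{-j'α} ≤ V_{γ,j} ≤ max(C₂, f_max/δ₂^α) (√d 2^{-j})^α`. -/
theorem statement12 (d : ℕ) (hd : 1 ≤ d) (α C₁ C₂ C₃ ε₀ δ₁ δ₂ fmax γ : ℝ)
    (hα : 0 < α) (hC₁ : 0 < C₁) (hC₂ : 0 < C₂) (hC₃ : 0 < C₃) (hε₀ : 0 < ε₀)
    (hδ₁ : 0 < δ₁) (hδ₂ : 0 < δ₂) (hfmax : 0 < fmax) (hγ : 0 < γ) (hγf : γ < fmax)
    (f : Pt d → ℝ) (P : Measure (Pt d)) (hf : IsDensity d f P) (hb : BoundedBy d f fmax)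
    (hA1 : A1 d f γ C₁ δ₁ α) (hA2 : A2 d f γ C₂ δ₂ α) (hB : AB d (Gstar d f γ) C₃ ε₀)
    (s : ℕ → ℝ) (hmono : Monotone s) (hdiv : Tendsto s atTop atTop) (hpos : ∀ m, 0 < s m)
    (n : ℕ) (hsn : 8 * max (3 * ε₀⁻¹) (max 28 (12 * C₃)) * Real.sqrt d < s n) :
    ∀ j : ℕ,
      min δ₁ C₁ * (((2 : ℝ) ^ jprime j (s n))⁻¹) ^ α ≤ V d P γ j (jprime j (s n)) ∧
      V d P γ j (jprime j (s n)) ≤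
        max C₂ (fmax / δ₂ ^ α) * (Real.sqrt d * ((2 : ℝ) ^ j)⁻¹) ^ α :=
  fun j => ⟨le_V hd hα hC₁ hε₀ hδ₁ hf hA1 hB (hA2.imp fun _ h => h.1) hsn j,
    V_le hα hC₂ hδ₂ hγ hγf hf hb hA2 j _⟩

end
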